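/- Fix an integer n ≥ 2, x₀ > 0, and fees 0 ≤ ĉ < c < 1. Let λ(·) = (1 - n·(·) + (n-1)·(·)^{n/(n-1)})/n. Let s : [0,∞) → [0,∞) be continuous and strictly increasing with s(0) = 0, and suppose there exist x̄_c, x̄_ĉ > 0 with s(x̄_c) = (1-c)·s(x₀)/λ(c) and s(x̄_ĉ) = (1-ĉ)·s(x₀)/λ(ĉ). Define the equilibrium cdfs G_c(x) = (c + λ(c)·s(x)/s(x₀))^{1/(n-1)} for x ∈ [0, x̄_c] and G_c(x) = 1 for x ≥ x̄_c, and similarly G_ĉ with ĉ. Then G_ĉ is strictly single-crossing with respect to G_c: there exists x* ∈ (0, x̄_c) such that G_c(x) > G_ĉ(x) for all x ∈ [0, x*), G_c(x*) = G_ĉ(x*), and G_c(x) < G_ĉ(x) for all x ∈ (x*, x̄_c). -/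

import Mathlib

/-- The slope coefficient `λ(c) = (1 - n·c + (n-1)·c^{n/(n-1)})/n` of the equilibrium
winning probability in the `n`-player risk-taking contest with submission fee `c`. -/
noncomputable def lamFee (n : ℕ) (c : ℝ) : ℝ :=
  (1 - n * c + ((n : ℝ) - 1) * c ^ ((n : ℝ) / ((n : ℝ) - 1))) / n

theorem lamFee_pos {n : ℕ} (hn : 2 ≤ n) {c : ℝ} (h0 : 0 ≤ c) (h1 : c < 1) :
    0 < lamFee n c := by
  have hn' : (2 : ℝ) ≤ n := by exact_mod_cast hn
  have hm : (0 : ℝ) < (n : ℝ) - 1 := by linarith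
  have hp : 1 < (n : ℝ) / ((n : ℝ) - 1) := by
    rw [lt_div_iff₀ hm]; linarith
  have hb := one_add_mul_self_lt_rpow_one_add (s := c - 1) (by linarith) (by linarith) hp
  rw [add_sub_cancel] at hb
  have hb' := mul_lt_mul_of_pos_left hb hm
  have he : ((n : ℝ) - 1) * (1 + (n : ℝ) / ((n : ℝ) - 1) * (c - 1)) = n * c - 1 := by
    field_simp
    ring
  unfold lamFee
  apply div_pos _ (by linarith)
  linarith

/-- The ratio `λ(c) / (1 - c)` is strictly decreasing in `c`, in cross-multiplied form. -/
theorem lamFee_mul_one_sub_lt {n : ℕ} (hn : 2 ≤ n) {c c' : ℝ} (h0 : 0 ≤ c') (h : c' < c)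
    (h1 : c < 1) : lamFee n c * (1 - c') < lamFee n c' * (1 - c) := by
  have hn' : (2 : ℝ) ≤ n := by exact_mod_cast hn
  have hm : (0 : ℝ) < (n : ℝ) - 1 := by linarith
  have hp : 1 < (n : ℝ) / ((n : ℝ) - 1) := by
    rw [lt_div_iff₀ hm]; linarith
  have hd : 0 < 1 - c' := by linarith
  have hcc := strictConvexOn_rpow hp
  have hcv := hcc.2 (Set.mem_Ici.2 h0) (Set.mem_Ici.2 zero_le_one) (h.trans h1).ne
    (div_pos (by linarith : 0 < 1 - c) hd) (div_pos (by linarith : 0 < c - c') hd)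
    (by field_simp; ring)
  have he : ((1 - c) / (1 - c')) • c' + ((c - c') / (1 - c')) • (1 : ℝ) = c := by
    simp only [smul_eq_mul]
    field_simp
    ring
  rw [he] at hcv
  simp only [smul_eq_mul, Real.one_rpow] at hcv
  unfold lamFee
  generalize c ^ ((n : ℝ) / ((n : ℝ) - 1)) = u at *
  generalize c' ^ ((n : ℝ) / ((n : ℝ) - 1)) = v at *
  have hcv' : u * (1 - c') < (1 - c) * v + (c - c') := by
    have := mul_lt_mul_of_pos_right hcv hd
    rwa [show ((1 - c) / (1 - c') * v + (c - c') / (1 - c') * 1) * (1 - c')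
      = (1 - c) * v + (c - c') by field_simp] at this
  rw [div_mul_eq_mul_div, div_mul_eq_mul_div]
  apply div_lt_div_of_pos_right _ (by linarith)
  linarith [mul_lt_mul_of_pos_left hcv' hm]

/-- Strict single-crossing of equilibrium distributions (Lemma 1 of the paper): for the
general nonnegative time-homogeneous diffusion with scale function `s` (continuous,
strictly increasing, `s(0) = 0`), the equilibrium cdf for a lower fee `c'` crosses the
equilibrium cdf for a higher fee `c` exactly once, from below-above to above-below. -/
theorem equilibrium_strict_single_crossing (n : ℕ) (hn : 2 ≤ n)
    (x₀ : ℝ) (hx₀ : 0 < x₀) (c c' : ℝ) (hc' : 0 ≤ c') (hc'c : c' < c) (hc : c < 1)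
    (s : ℝ → ℝ) (hs_cont : ContinuousOn s (Set.Ici 0))
    (hs_mono : StrictMonoOn s (Set.Ici 0)) (hs0 : s 0 = 0)
    (xbc xbc' : ℝ) (hxbc : 0 < xbc) (hxbc' : 0 < xbc')
    (hsc : s xbc = (1 - c) * s x₀ / lamFee n c)
    (hsc' : s xbc' = (1 - c') * s x₀ / lamFee n c')
    (G Ghat : ℝ → ℝ)
    (hG : ∀ x : ℝ, 0 ≤ x →
      G x = if x ≤ xbc then (c + lamFee n c * s x / s x₀) ^ ((1 : ℝ) / ((n : ℝ) - 1)) else 1)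
    (hGhat : ∀ x : ℝ, 0 ≤ x →
      Ghat x = if x ≤ xbc' then (c' + lamFee n c' * s x / s x₀) ^ ((1 : ℝ) / ((n : ℝ) - 1)) else 1) :
    ∃ xstar ∈ Set.Ioo (0 : ℝ) xbc,
      (∀ x : ℝ, 0 ≤ x → x < xstar → Ghat x < G x) ∧
      G xstar = Ghat xstar ∧
      (∀ x : ℝ, xstar < x → x < xbc → G x < Ghat x) := by
  have hL := lamFee_pos hn (hc'.trans hc'c.le) hc
  have hL' := lamFee_pos hn hc' (hc'c.trans hc)
  have hK := lamFee_mul_one_sub_lt hn hc' hc'c hc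
  generalize lamFee n c = L at *
  generalize lamFee n c' = L' at *
  have hLL : L < L' := by
    by_contra! hle
    nlinarith
  have hD : 0 < L' - L := by linarith
  have hS : 0 < s x₀ := hs0 ▸ hs_mono (Set.mem_Ici.2 le_rfl) hx₀.le hx₀
  have hm : (0 : ℝ) < (n : ℝ) - 1 := by
    have : (2 : ℝ) ≤ n := by exact_mod_cast hn
    linarith
  have hp : 0 < (1 : ℝ) / ((n : ℝ) - 1) := by positivity
  have hlt : (c - c') / (L' - L) * s x₀ < s xbc := by
    rw [hsc, div_mul_eq_mul_div, div_lt_div_iff₀ hD hL]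
    nlinarith
  have hlt' : (c - c') / (L' - L) * s x₀ < s xbc' := by
    rw [hsc', div_mul_eq_mul_div, div_lt_div_iff₀ hD hL']
    nlinarith
  have hpos : 0 < (c - c') / (L' - L) * s x₀ := mul_pos (div_pos (by linarith) hD) hS
  obtain ⟨z, hz, hsz⟩ := intermediate_value_Ioo hxbc.le
    (hs_cont.mono Set.Icc_subset_Ici_self) ⟨hs0.trans_lt hpos, hlt⟩
  have hz0 : 0 ≤ z := hz.1.le
  have hzx' : z < xbc' := (hs_mono.lt_iff_lt hz0 hxbc'.le).1 (hsz ▸ hlt')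
  have hsz' : L' * s z / s x₀ - L * s z / s x₀ = c - c' := by
    rw [hsz]
    field_simp
  have hgap : ∀ x, (c' + L' * s x / s x₀) - (c + L * s x / s x₀)
      = (L' - L) * (s x - s z) / s x₀ := by
    intro x
    rw [show c = c' + (L' * s z / s x₀ - L * s z / s x₀) by linarith]
    ring
  have hnn : ∀ x, 0 ≤ x → 0 ≤ s x := fun x hx =>
    hs0 ▸ hs_mono.monotoneOn (Set.mem_Ici.2 le_rfl) hx hx
  have hc0 : 0 ≤ c := hc'.trans hc'c.le
  have hbase : ∀ x, 0 ≤ x → 0 ≤ c + L * s x / s x₀ := fun x hx =>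
    add_nonneg hc0 (div_nonneg (mul_nonneg hL.le (hnn x hx)) hS.le)
  have hbase' : ∀ x, 0 ≤ x → 0 ≤ c' + L' * s x / s x₀ := fun x hx =>
    add_nonneg hc' (div_nonneg (mul_nonneg hL'.le (hnn x hx)) hS.le)
  refine ⟨z, hz, fun x hx hxz => ?_, ?_, fun x hzx hxb => ?_⟩
  · rw [hG x hx, hGhat x hx, if_pos (hxz.trans hz.2).le, if_pos (hxz.trans hzx').le]
    refine Real.rpow_lt_rpow (hbase' x hx) ?_ hp
    have hneg : (L' - L) * (s x - s z) / s x₀ < 0 :=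
      div_neg_of_neg_of_pos (mul_neg_of_pos_of_neg hD (sub_neg.2 (hs_mono hx hz0 hxz))) hS
    linarith [hgap x]
  · rw [hG z hz0, hGhat z hz0, if_pos hz.2.le, if_pos hzx'.le]
    congr 1
    linarith
  · have hx : 0 ≤ x := hz0.trans hzx.le
    rw [hG x hx, hGhat x hx, if_pos hxb.le]
    split_ifs with hxb'
    · refine Real.rpow_lt_rpow (hbase x hx) ?_ hp
      have := div_pos (mul_pos hD (sub_pos.2 (hs_mono hz0 hx hzx))) hS
      linarith [hgap x]
    · refine Real.rpow_lt_one (hbase x hx) ?_ hp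
      have hsx : s x < (1 - c) * s x₀ / L := hsc ▸ hs_mono hx hxbc.le hxb
      rw [lt_div_iff₀ hL] at hsx
      have : L * s x / s x₀ < 1 - c := by
        rw [div_lt_iff₀ hS]
        linarith
      linarith
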